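/- arXiv:2012.04678 — 4 statements merged into one kernel-verified Lean document; each statement's English description precedes it below -/
import Mathlib

section
/- Let (A,B,C,D) be a minimal LTI system with state dimension n_x, input dimension n_u and output dimension n_y, and let (u^d, y^d) be a length-N trajectory of the system (noise-free data). Let L = L₀ + L' with L₀ ≥ n_x and L ≤ N, set M = N − L + 1, and assume the input data u^d is persistently exciting of order L + n_x. Then for any sequences u_ini, y_ini of length L₀ and û, ŷ of length L', the concatenated pair (col(u_ini, û), col(y_ini, ŷ)) is a length-L trajectory of (A,B,C,D) if and only if there exists g ∈ ℝ^M such that H_L(u^d)·g = col(u_ini, û) and H_L(y^d)·g = col(y_ini, ŷ). -/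
open Matrix

/-- `(u, y)` is a length-`T` input-output trajectory of the LTI system `(A, B, C, D)`. -/
def IsTraj {n_x n_u n_y : ℕ} (A : Matrix (Fin n_x) (Fin n_x) ℝ) (B : Matrix (Fin n_x) (Fin n_u) ℝ)
    (C : Matrix (Fin n_y) (Fin n_x) ℝ) (D : Matrix (Fin n_y) (Fin n_u) ℝ) (T : ℕ)
    (u : Fin T → Fin n_u → ℝ) (y : Fin T → Fin n_y → ℝ) : Prop :=
  ∃ x : Fin (T + 1) → Fin n_x → ℝ, ∀ t : Fin T,
    x t.succ = A.mulVec (x t.castSucc) + B.mulVec (u t) ∧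
    y t = C.mulVec (x t.castSucc) + D.mulVec (u t)

/-- Block Hankel matrix with `L` block rows built from the length-`N` signal `z`. -/
def hankel {d N : ℕ} (L : ℕ) (hL : L ≤ N) (z : Fin N → Fin d → ℝ) :
    Matrix (Fin L × Fin d) (Fin (N - L + 1)) ℝ :=
  fun p j => z ⟨p.1.1 + j.1, by have h1 := p.1.isLt; have h2 := j.isLt; omega⟩ p.2

/-- Controllability matrix `[B, AB, …, A^{n_x−1}B]`. -/
def ctrbMat {n_x n_u : ℕ} (A : Matrix (Fin n_x) (Fin n_x) ℝ)
    (B : Matrix (Fin n_x) (Fin n_u) ℝ) : Matrix (Fin n_x) (Fin n_x × Fin n_u) ℝ :=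
  fun i p => (A ^ p.1.1 * B) i p.2

/-- Observability matrix `col(C, CA, …, CA^{n_x−1})`. -/
def obsvMat {n_x n_y : ℕ} (A : Matrix (Fin n_x) (Fin n_x) ℝ)
    (C : Matrix (Fin n_y) (Fin n_x) ℝ) : Matrix (Fin n_x × Fin n_y) (Fin n_x) ℝ :=
  fun p j => (C * A ^ p.1.1) p.2 j

lemma state_formula {n m : ℕ} (A : Matrix (Fin n) (Fin n) ℝ) (B : Matrix (Fin n) (Fin m) ℝ)
    (x : ℕ → Fin n → ℝ) (u : ℕ → Fin m → ℝ) (N : ℕ)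
    (hx : ∀ t < N, x (t+1) = A *ᵥ x t + B *ᵥ u t) (j k : ℕ) (h : j + k ≤ N) (ξ : Fin n → ℝ) :
    ξ ⬝ᵥ x (j+k) = (ξ ᵥ* A^k) ⬝ᵥ x j
      + ∑ i ∈ Finset.range k, (ξ ᵥ* (A^(k-1-i) * B)) ⬝ᵥ u (i + j) := by
  induction k generalizing ξ with
  | zero => simp
  | succ k ih =>
    rw [← add_assoc, hx (j+k) (by omega), dotProduct_add, dotProduct_mulVec, dotProduct_mulVec,
      ih (by omega), Finset.sum_range_succ, vecMul_vecMul, ← pow_succ', add_assoc]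
    congr 2
    · apply Finset.sum_congr rfl
      intro i hi
      rw [Finset.mem_range] at hi
      rw [vecMul_vecMul, ← Matrix.mul_assoc, ← pow_succ',
        show k - 1 - i + 1 = k + 1 - 1 - i by omega]
    · simp [add_comm]

lemma key {n m : ℕ} (A : Matrix (Fin n) (Fin n) ℝ) (B : Matrix (Fin n) (Fin m) ℝ)
    (x : ℕ → Fin n → ℝ) (u : ℕ → Fin m → ℝ) (N L : ℕ)
    (hx : ∀ t < N, x (t+1) = A *ᵥ x t + B *ᵥ u t) (hN : L + n ≤ N)
    (hPE : ∀ v : ℕ → Fin m → ℝ, (∀ j ≤ N - (L+n),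
      ∑ p ∈ Finset.range (L+n), v p ⬝ᵥ u (p+j) = 0) → ∀ p < L + n, v p = 0)
    (hc : ∀ ξ : Fin n → ℝ, (∀ k < n, ξ ᵥ* (A^k * B) = 0) → ξ = 0)
    (ξ : Fin n → ℝ) (η : ℕ → Fin m → ℝ)
    (h : ∀ j ≤ N - L, ξ ⬝ᵥ x j + ∑ i ∈ Finset.range L, η i ⬝ᵥ u (i+j) = 0) :
    ξ = 0 ∧ ∀ i < L, η i = 0 := by
  set S : ℕ → Fin m → ℝ := fun p => if p < n then ξ ᵥ* (A^(n-1-p) * B) else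
    if p < n + L then η (p - n) else 0 with hS
  have h1 : ∀ j k, k ≤ n → j ≤ N - (L+n) →
      (ξ ᵥ* A^k) ⬝ᵥ x j + ∑ p ∈ Finset.range (L+n), S (p+n-k) ⬝ᵥ u (p+j) = 0 := by
    intro j k hk hj
    rw [← h (j+k) (by omega), state_formula A B x u N hx j k (by omega), add_assoc]
    congr 1
    have : L + n = k + L + (n - k) := by omega
    rw [this, Finset.sum_range_add, Finset.sum_range_add]
    have h3 : ∑ p ∈ Finset.range (n-k), S (k+L+p+n-k) ⬝ᵥ u (k+L+p+j) = 0 := by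
      apply Finset.sum_eq_zero
      intro p hp
      have : S (k+L+p+n-k) = 0 := by
        simp only [hS]
        rw [if_neg (by omega), if_neg (by omega)]
      rw [this, zero_dotProduct]
    rw [h3, add_zero]
    congr 1
    · apply Finset.sum_congr rfl
      intro p hp
      rw [Finset.mem_range] at hp
      simp only [hS]
      rw [if_pos (by omega), show n - 1 - (p + n - k) = k - 1 - p by omega]
    · apply Finset.sum_congr rfl
      intro p hp
      rw [Finset.mem_range] at hp
      simp only [hS]
      rw [if_neg (by omega), if_pos (by omega)]
      congr 2 <;> omega
  set c := A.charpoly.coeff with hcdef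
  have hdeg : A.charpoly.natDegree = n := by simp [Matrix.charpoly_natDegree_eq_dim]
  have hcn : c n = 1 := by
    have := A.charpoly_monic
    rw [Polynomial.Monic, Polynomial.leadingCoeff, hdeg] at this
    exact this
  have hCH : ∑ k ∈ Finset.range (n+1), c k • A^k = 0 := by
    have := A.aeval_self_charpoly
    rwa [Polynomial.aeval_eq_sum_range, hdeg] at this
  have h2 := hPE (fun p => ∑ k ∈ Finset.range (n+1), c k • S (p+n-k)) (by
    intro j hj
    have e1 : ∑ k ∈ Finset.range (n+1), c k * ((ξ ᵥ* A^k) ⬝ᵥ x j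
        + ∑ p ∈ Finset.range (L+n), S (p+n-k) ⬝ᵥ u (p+j)) = 0 := by
      apply Finset.sum_eq_zero
      intro k hk
      rw [Finset.mem_range] at hk
      rw [h1 j k (by omega) hj, mul_zero]
    have e2 : ∑ k ∈ Finset.range (n+1), c k * ((ξ ᵥ* A^k) ⬝ᵥ x j) = 0 := by
      have : (ξ ᵥ* ∑ k ∈ Finset.range (n+1), c k • A^k) ⬝ᵥ x j = 0 := by
        rw [hCH]; simp
      rw [← this, Matrix.vecMul_sum, sum_dotProduct]
      simp [Matrix.vecMul_smul, smul_dotProduct]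
    simp only [mul_add, Finset.sum_add_distrib] at e1
    rw [e2, zero_add] at e1
    rw [← e1]
    simp only [sum_dotProduct, smul_dotProduct, Finset.mul_sum, smul_eq_mul]
    exact Finset.sum_comm)
  have h4 : ∀ d p, L + n ≤ p + d → S p = 0 := by
    intro d
    induction d with
    | zero =>
      intro p hp
      simp only [hS]
      rw [if_neg (by omega), if_neg (by omega)]
    | succ d ih =>
      intro p hp
      by_cases hp' : L + n ≤ p + d
      · exact ih p hp'
      have := h2 p (by omega)
      rw [Finset.sum_range_succ, Finset.sum_eq_zero, hcn] at this
      · simpa using this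
      intro k hk
      rw [Finset.mem_range] at hk
      rw [ih _ (by omega), smul_zero]
  have h5 : ∀ p, S p = 0 := fun p => h4 (L+n) p (by omega)
  constructor
  · apply hc
    intro k hk
    have := h5 (n-1-k)
    simp only [hS] at this
    rw [if_pos (by omega)] at this
    rwa [show n-1-(n-1-k) = k by omega] at this
  · intro i hi
    have := h5 (n+i)
    simp only [hS] at this
    rw [if_neg (by omega), if_pos (by omega)] at this
    simpa using this

lemma vecMul_inj_of_rank {ι κ : Type*} [Fintype ι] [Fintype κ] [DecidableEq ι]
    (M : Matrix ι κ ℝ) (h : M.rank = Fintype.card ι) (v : ι → ℝ) (hv : v ᵥ* M = 0) : v = 0 := by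
  have : LinearIndependent ℝ M.row := by
    rw [linearIndependent_iff_card_eq_finrank_span, ← h, Matrix.rank_eq_finrank_span_row]; rfl
  rw [← Matrix.vecMul_injective_iff] at this
  exact this (by simpa using hv)

lemma mulVec_surj {ι κ : Type*} [Fintype ι] [Fintype κ] [DecidableEq ι]
    (M : Matrix ι κ ℝ) (h : ∀ v : ι → ℝ, v ᵥ* M = 0 → v = 0) (b : ι → ℝ) : ∃ g, M *ᵥ g = b := by
  have h1 : LinearIndependent ℝ M.row := by
    rw [← Matrix.vecMul_injective_iff]
    intro v w hvw
    have := h (v - w) (by rw [Matrix.sub_vecMul]; simpa [sub_eq_zero] using hvw)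
    exact sub_eq_zero.mp this
  have h2 := h1.rank_matrix
  have h3 : LinearMap.range M.mulVecLin = ⊤ := by
    apply Submodule.eq_top_of_finrank_eq
    rw [Module.finrank_fintype_fun_eq_card]; exact h2
  obtain ⟨g, hg⟩ := LinearMap.range_eq_top.mp h3 b
  exact ⟨g, hg⟩

/-- The weighted sum of shifted windows. -/
lemma shift_dyn {n m q r : ℕ} (A : Matrix (Fin r) (Fin n) ℝ) (B : Matrix (Fin r) (Fin m) ℝ)
    (x : ℕ → Fin n → ℝ) (u : ℕ → Fin m → ℝ) (z : ℕ → Fin r → ℝ) (t : ℕ) (g : Fin q → ℝ)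
    (h : ∀ j : Fin q, z (t + j) = A *ᵥ x (t + j) + B *ᵥ u (t + j)) :
    ∑ j, g j • z (t + j) = A *ᵥ (∑ j, g j • x (t + j)) + B *ᵥ (∑ j, g j • u (t + j)) := by
  simp only [h, Matrix.mulVec_sum, Matrix.mulVec_smul, smul_add, Finset.sum_add_distrib]

/-- Willems' fundamental lemma: with noise-free data from a minimal system and a persistently
exciting input of order `L + n_x` (`L = L₀ + L'`), a pair `(col(u_ini, û), col(y_ini, ŷ))` is a
length-`L` trajectory iff it is in the range of the signal matrix. -/
theorem fundamental_lemma {n_x n_u n_y N L0 L' : ℕ}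
    (A : Matrix (Fin n_x) (Fin n_x) ℝ) (B : Matrix (Fin n_x) (Fin n_u) ℝ)
    (C : Matrix (Fin n_y) (Fin n_x) ℝ) (D : Matrix (Fin n_y) (Fin n_u) ℝ)
    (hctrb : (ctrbMat A B).rank = n_x) (hobsv : (obsvMat A C).rank = n_x)
    (ud : Fin N → Fin n_u → ℝ) (yd : Fin N → Fin n_y → ℝ)
    (hdata : IsTraj A B C D N ud yd)
    (hL0 : n_x ≤ L0) (hLN : L0 + L' ≤ N) (hPEN : L0 + L' + n_x ≤ N)
    (hPE : (hankel (L0 + L' + n_x) hPEN ud).rank = (L0 + L' + n_x) * n_u)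
    (u_ini : Fin L0 → Fin n_u → ℝ) (uhat : Fin L' → Fin n_u → ℝ)
    (y_ini : Fin L0 → Fin n_y → ℝ) (yhat : Fin L' → Fin n_y → ℝ) :
    IsTraj A B C D (L0 + L') (Fin.append u_ini uhat) (Fin.append y_ini yhat) ↔
      ∃ g : Fin (N - (L0 + L') + 1) → ℝ,
        (hankel (L0 + L') hLN ud).mulVec g = (fun p => Fin.append u_ini uhat p.1 p.2) ∧
        (hankel (L0 + L') hLN yd).mulVec g = (fun p => Fin.append y_ini yhat p.1 p.2) := by
  obtain ⟨xd, hxd⟩ := hdata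
  set L := L0 + L' with hLdef
  set X : ℕ → Fin n_x → ℝ := fun t => if h : t < N + 1 then xd ⟨t, h⟩ else 0 with hX
  set U : ℕ → Fin n_u → ℝ := fun t => if h : t < N then ud ⟨t, h⟩ else 0 with hU
  set Y : ℕ → Fin n_y → ℝ := fun t => if h : t < N then yd ⟨t, h⟩ else 0 with hY
  have hUe : ∀ t (h : t < N), ud ⟨t, h⟩ = U t := fun t h => by simp [hU, h]
  have hYe : ∀ t (h : t < N), yd ⟨t, h⟩ = Y t := fun t h => by simp [hY, h]
  have hXe : ∀ t (h : t < N + 1), xd ⟨t, h⟩ = X t := fun t h => by simp only [hX, dif_pos h]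
  have hdx : ∀ t < N, X (t+1) = A *ᵥ X t + B *ᵥ U t := by
    intro t ht
    have := (hxd ⟨t, ht⟩).1
    simpa only [Fin.succ_mk, Fin.castSucc_mk, hUe, hXe] using this
  have hdy : ∀ t < N, Y t = C *ᵥ X t + D *ᵥ U t := by
    intro t ht
    have := (hxd ⟨t, ht⟩).2
    simpa only [Fin.succ_mk, Fin.castSucc_mk, hUe, hXe, hYe] using this
  have hgu : ∀ (g : Fin (N - L + 1) → ℝ) (t : Fin L) (i : Fin n_u),
      (hankel L hLN ud *ᵥ g) (t, i) = (∑ j, g j • U (t + j)) i := by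
    intro g t i
    simp [Matrix.mulVec, dotProduct, hankel, hUe, mul_comm]
  have hgy : ∀ (g : Fin (N - L + 1) → ℝ) (t : Fin L) (i : Fin n_y),
      (hankel L hLN yd *ᵥ g) (t, i) = (∑ j, g j • Y (t + j)) i := by
    intro g t i
    simp [Matrix.mulVec, dotProduct, hankel, hYe, mul_comm]
  have hsx : ∀ (g : Fin (N - L + 1) → ℝ) (t : ℕ), t < L →
      ∑ j, g j • X (t + 1 + j) =
        A *ᵥ (∑ j, g j • X (t + j)) + B *ᵥ (∑ j, g j • U (t + j)) := by
    intro g t ht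
    have := shift_dyn A B X U (fun t => X (t+1)) t g (fun j => hdx _ (by omega))
    simpa only [add_right_comm] using this
  have hsy : ∀ (g : Fin (N - L + 1) → ℝ) (t : ℕ), t < L →
      ∑ j, g j • Y (t + j) =
        C *ᵥ (∑ j, g j • X (t + j)) + D *ᵥ (∑ j, g j • U (t + j)) := by
    intro g t ht
    exact shift_dyn C D X U Y t g (fun j => hdy _ (by omega))
  constructor
  · rintro ⟨x, hx⟩
    obtain ⟨g, hg⟩ := mulVec_surj
      (Matrix.fromRows (Matrix.of fun (i : Fin n_x) (j : Fin (N - L + 1)) => X j i)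
        (hankel L hLN ud)) (by
        intro v hv
        have hk := key A B X U N L hdx hPEN (by
            intro w hw
            have := vecMul_inj_of_rank _ (hPE.trans (by simp)) (fun p => w p.1 p.2) (by
              ext j
              have := hw j (by omega)
              rw [Finset.sum_range] at this
              rw [Pi.zero_apply, ← this]
              simp [Matrix.vecMul, dotProduct, hankel, hUe, Fintype.sum_prod_type]
              rfl)
            intro p hp
            ext i
            exact congrFun this (⟨p, hp⟩, i))
          (by
            intro ξ hξ
            apply vecMul_inj_of_rank _ (hctrb.trans (by simp))
            ext ⟨k, i⟩
            exact congrFun (hξ k k.2) i)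
          (fun i => v (Sum.inl i))
          (fun t i => if h : t < L then v (Sum.inr (⟨t, h⟩, i)) else 0)
          (by
            intro j hj
            have := congrFun hv ⟨j, by omega⟩
            rw [Pi.zero_apply] at this
            rw [← this, Finset.sum_range]
            simp [Matrix.vecMul, dotProduct, hankel, hUe, Fintype.sum_prod_type])
        ext (i | ⟨t, i⟩)
        · exact congrFun hk.1 i
        · have := congrFun (hk.2 t t.2) i
          simpa using this)
      (Sum.elim (x 0) (fun p => Fin.append u_ini uhat p.1 p.2))
    rw [Matrix.fromRows_mulVec] at hg
    have hg1 : ∑ j, g j • X (0 + j) = x 0 := by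
      ext i
      have := congrFun hg (Sum.inl i)
      simpa [Matrix.mulVec, dotProduct, mul_comm] using this
    have hg2 : hankel L hLN ud *ᵥ g = (fun p => Fin.append u_ini uhat p.1 p.2) := by
      ext p
      exact congrFun hg (Sum.inr p)
    have hg3 : ∀ t : Fin L, ∑ j, g j • U (t + j) = Fin.append u_ini uhat t := by
      intro t
      ext i
      rw [← hgu, hg2]
    have hst : ∀ t (h : t < L + 1), ∑ j, g j • X (t + j) = x ⟨t, h⟩ := by
      intro t
      induction t with
      | zero => intro h; exact hg1
      | succ t ih =>
        intro h
        have := (hx ⟨t, by omega⟩).1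
        rw [Fin.succ_mk, Fin.castSucc_mk, ← ih (by omega), ← hg3] at this
        rw [this]
        exact hsx g t (by omega)
    refine ⟨g, hg2, ?_⟩
    ext ⟨t, i⟩
    rw [hgy, hsy g t t.2, hg3, hst t (by omega)]
    exact (congrFun (hx t).2 i).symm
  · rintro ⟨g, hg2, hg4⟩
    have hg3 : ∀ t : Fin L, ∑ j, g j • U (t + j) = Fin.append u_ini uhat t := by
      intro t
      ext i
      rw [← hgu, hg2]
    have hg5 : ∀ t : Fin L, ∑ j, g j • Y (t + j) = Fin.append y_ini yhat t := by
      intro t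
      ext i
      rw [← hgy, hg4]
    refine ⟨fun t => ∑ j, g j • X (t + j), fun t => ⟨?_, ?_⟩⟩
    · rw [← hg3]
      exact hsx g t t.2
    · rw [← hg3, ← hg5]
      exact hsy g t t.2
end

section
/- Let (A,B,C,D) be an LTI system with state dimension n_x such that the observability matrix col(C, CA, …, CA^{n_x−1}) has rank n_x, and let L ≥ n_x. Then the set of length-L trajectories of (A,B,C,D), viewed as vectors col(u, y) ∈ ℝ^{L·n_u + L·n_y}, is a linear subspace of dimension n_x + L·n_u. -/
open Matrix

/-- The state at time `t`, as a linear function of the initial state and the input. -/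
def stateMap {n_x n_u : ℕ} (L : ℕ) (A : Matrix (Fin n_x) (Fin n_x) ℝ)
    (B : Matrix (Fin n_x) (Fin n_u) ℝ) :
    ℕ → ((Fin n_x → ℝ) × ((Fin L × Fin n_u) → ℝ)) →ₗ[ℝ] (Fin n_x → ℝ)
  | 0 => LinearMap.fst ℝ _ _
  | t + 1 => A.mulVecLin ∘ₗ stateMap L A B t +
      (if h : t < L then
        B.mulVecLin ∘ₗ (LinearMap.funLeft ℝ ℝ (fun i : Fin n_u => ((⟨t, h⟩ : Fin L), i))) ∘ₗ
          LinearMap.snd ℝ _ _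
      else 0)

/-- The linear map sending initial state and input to the stacked trajectory. -/
def trajMap {n_x n_u n_y : ℕ} (L : ℕ) (A : Matrix (Fin n_x) (Fin n_x) ℝ)
    (B : Matrix (Fin n_x) (Fin n_u) ℝ)
    (C : Matrix (Fin n_y) (Fin n_x) ℝ) (D : Matrix (Fin n_y) (Fin n_u) ℝ) :
    ((Fin n_x → ℝ) × ((Fin L × Fin n_u) → ℝ)) →ₗ[ℝ]
      (((Fin L × Fin n_u) ⊕ (Fin L × Fin n_y)) → ℝ) where
  toFun p := Sum.elim p.2 (fun q =>
    (C.mulVec (stateMap L A B q.1 p) + D.mulVec (fun i => p.2 (q.1, i))) q.2)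
  map_add' p q := by
    funext k
    rcases k with k | k
    · simp
    · have h : (fun i => (p + q).2 (k.1, i)) =
          (fun i => p.2 (k.1, i)) + (fun i => q.2 (k.1, i)) := rfl
      simp only [Sum.elim_inr, Pi.add_apply, h, map_add, Matrix.mulVec_add]
      ring
  map_smul' c p := by
    funext k
    rcases k with k | k
    · simp
    · have h : (fun i => (c • p).2 (k.1, i)) = c • (fun i => p.2 (k.1, i)) := rfl
      simp only [Sum.elim_inr, Pi.add_apply, h, map_smul, Matrix.mulVec_smul, Pi.smul_apply,
        RingHom.id_apply, smul_add]

lemma stateMap_succ {n_x n_u L : ℕ} (A : Matrix (Fin n_x) (Fin n_x) ℝ)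
    (B : Matrix (Fin n_x) (Fin n_u) ℝ) (p : (Fin n_x → ℝ) × ((Fin L × Fin n_u) → ℝ))
    (t : Fin L) :
    stateMap L A B (t + 1) p =
      A.mulVec (stateMap L A B t p) + B.mulVec (fun i => p.2 (t, i)) := by
  simp only [stateMap, t.2, dif_pos]
  rfl

lemma stateMap_zero_input {n_x n_u L : ℕ} (A : Matrix (Fin n_x) (Fin n_x) ℝ)
    (B : Matrix (Fin n_x) (Fin n_u) ℝ) (x : Fin n_x → ℝ) (t : ℕ) (ht : t ≤ L) :
    stateMap L A B t (x, 0) = (A ^ t).mulVec x := by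
  induction t with
  | zero => simp [stateMap]
  | succ t ih =>
    have h := stateMap_succ A B (x, (0 : (Fin L × Fin n_u) → ℝ)) ⟨t, ht⟩
    have h0 : (fun i : Fin n_u => ((x, (0 : (Fin L × Fin n_u) → ℝ)).2 ((⟨t, ht⟩ : Fin L), i)))
      = 0 := rfl
    rw [h0, Matrix.mulVec_zero, add_zero] at h
    simp only at h
    rw [h, ih (by omega), Matrix.mulVec_mulVec, pow_succ']

lemma obsv_injective {n_x n_y : ℕ} (A : Matrix (Fin n_x) (Fin n_x) ℝ)
    (C : Matrix (Fin n_y) (Fin n_x) ℝ) (h : (obsvMat A C).rank = n_x)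
    (x : Fin n_x → ℝ) (hx : (obsvMat A C).mulVec x = 0) : x = 0 := by
  have h1 := LinearMap.finrank_range_add_finrank_ker (obsvMat A C).mulVecLin
  rw [Matrix.rank] at h
  rw [h, Module.finrank_fin_fun] at h1
  have h2 : LinearMap.ker (obsvMat A C).mulVecLin = ⊥ :=
    Submodule.finrank_eq_zero.mp (by omega)
  have h3 : x ∈ LinearMap.ker (obsvMat A C).mulVecLin := hx
  rw [h2] at h3
  exact h3

lemma trajMap_injective {n_x n_u n_y L : ℕ}
    (A : Matrix (Fin n_x) (Fin n_x) ℝ) (B : Matrix (Fin n_x) (Fin n_u) ℝ)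
    (C : Matrix (Fin n_y) (Fin n_x) ℝ) (D : Matrix (Fin n_y) (Fin n_u) ℝ)
    (hobsv : (obsvMat A C).rank = n_x) (hL : n_x ≤ L) :
    Function.Injective (trajMap L A B C D) := by
  rw [injective_iff_map_eq_zero]
  rintro ⟨x, u⟩ h
  have hu : u = 0 := by
    funext k
    exact congrFun h (Sum.inl k)
  subst hu
  have hx : x = 0 := by
    apply obsv_injective A C hobsv
    funext k
    have hk : k.1.1 < L := lt_of_lt_of_le k.1.2 hL
    have h1 : (C.mulVec (stateMap L A B k.1.1 (x, (0 : (Fin L × Fin n_u) → ℝ))) +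
      D.mulVec (0 : Fin n_u → ℝ)) k.2 = 0 := congrFun h (Sum.inr (⟨k.1.1, hk⟩, k.2))
    rw [stateMap_zero_input A B x _ hk.le, Matrix.mulVec_zero, add_zero,
      Matrix.mulVec_mulVec] at h1
    exact h1
  rw [hx]
  rfl

/-- For an observable system and `L ≥ n_x`, the set of length-`L` trajectories, viewed as
stacked vectors `col(u, y)`, is a linear subspace of dimension `n_x + L·n_u`. -/
theorem trajectory_set_is_subspace {n_x n_u n_y L : ℕ}
    (A : Matrix (Fin n_x) (Fin n_x) ℝ) (B : Matrix (Fin n_x) (Fin n_u) ℝ)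
    (C : Matrix (Fin n_y) (Fin n_x) ℝ) (D : Matrix (Fin n_y) (Fin n_u) ℝ)
    (hobsv : (obsvMat A C).rank = n_x) (hL : n_x ≤ L) :
    ∃ W : Submodule ℝ (((Fin L × Fin n_u) ⊕ (Fin L × Fin n_y)) → ℝ),
      (W : Set (((Fin L × Fin n_u) ⊕ (Fin L × Fin n_y)) → ℝ)) =
        {v | IsTraj A B C D L (fun t i => v (Sum.inl (t, i))) (fun t i => v (Sum.inr (t, i)))} ∧
      Module.finrank ℝ W = n_x + L * n_u := by
  refine ⟨LinearMap.range (trajMap L A B C D), ?_, ?_⟩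
  · ext v
    constructor
    · rintro ⟨p, rfl⟩
      refine ⟨fun t => stateMap L A B t p, fun t => ⟨?_, rfl⟩⟩
      exact stateMap_succ A B p t
    · rintro ⟨x, hx⟩
      refine ⟨(x 0, fun k => v (Sum.inl k)), ?_⟩
      have key : ∀ t : ℕ, ∀ ht : t < L + 1,
          stateMap L A B t (x 0, fun k => v (Sum.inl k)) = x ⟨t, ht⟩ := by
        intro t
        induction t with
        | zero => intro ht; rfl
        | succ t ih =>
          intro ht
          have htL : t < L := by omega
          have h := stateMap_succ A B (x 0, fun k => v (Sum.inl k)) (⟨t, htL⟩ : Fin L)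
          simp only at h
          rw [h, ih (by omega)]
          exact (hx ⟨t, htL⟩).1.symm
      funext k
      rcases k with k | ⟨t, i⟩
      · rfl
      · have h1 := congrFun (hx t).2 i
        simp only at h1
        rw [h1]
        change (C.mulVec (stateMap L A B t (x 0, fun k => v (Sum.inl k))) + _) i = _
        rw [key t (by omega)]
        rfl
  · rw [LinearMap.finrank_range_of_inj (trajMap_injective A B C D hobsv hL)]
    simp
end

section
/- Let (A,B,C,D) be a minimal LTI system with state dimension n_x, input dimension n_u and output dimension n_y, let (u^d, y^d) be a length-N trajectory of the system, let L ≥ n_x, and assume u^d is persistently exciting of order L + n_x. Then the noise-free signal matrix col(H_L(u^d), H_L(y^d)) has rank exactly n_x + n_u·L. -/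
open Matrix

theorem aux_ker {m n : Type*} [Fintype m] [Fintype n] [DecidableEq m] [DecidableEq n]
    (M : Matrix m n ℝ) (h : M.rank = Fintype.card n) (v : n → ℝ) (hv : M *ᵥ v = 0) : v = 0 := by
  have h1 := LinearMap.finrank_range_add_finrank_ker M.mulVecLin
  rw [Matrix.rank] at h
  rw [h, Module.finrank_fintype_fun_eq_card] at h1
  have h2 : Module.finrank ℝ (LinearMap.ker M.mulVecLin) = 0 := by omega
  have h3 := Submodule.finrank_eq_zero.mp h2
  have : v ∈ LinearMap.ker M.mulVecLin := by simpa using hv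
  rw [h3] at this
  simpa using this

theorem aux_left {m n : Type*} [Fintype m] [Fintype n] [DecidableEq m] [DecidableEq n]
    (M : Matrix m n ℝ) (h : M.rank = Fintype.card m) (v : m → ℝ) (hv : v ᵥ* M = 0) : v = 0 := by
  apply aux_ker Mᵀ (by rw [Matrix.rank_transpose, h]) v
  rw [Matrix.mulVec_transpose, hv]

theorem aux_rank_left {m n : Type*} [Fintype m] [Fintype n] [DecidableEq m] [DecidableEq n]
    (M : Matrix m n ℝ) (h : ∀ v : m → ℝ, v ᵥ* M = 0 → v = 0) : M.rank = Fintype.card m := by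
  rw [← Matrix.rank_transpose]
  have h1 := LinearMap.finrank_range_add_finrank_ker Mᵀ.mulVecLin
  have h3 : LinearMap.ker Mᵀ.mulVecLin = ⊥ := by
    rw [LinearMap.ker_eq_bot']
    intro v hv
    apply h
    simpa [Matrix.mulVec_transpose] using hv
  rw [h3, Module.finrank_fintype_fun_eq_card] at h1
  simpa [Matrix.rank] using h1

theorem aux_rank_eq {m m' n : Type*} [Fintype m] [Fintype m'] [Fintype n] [DecidableEq n]
    (M : Matrix m n ℝ) (M' : Matrix m' n ℝ) (h : ∀ v : n → ℝ, M *ᵥ v = 0 ↔ M' *ᵥ v = 0) :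
    M.rank = M'.rank := by
  have h1 := LinearMap.finrank_range_add_finrank_ker M.mulVecLin
  have h2 := LinearMap.finrank_range_add_finrank_ker M'.mulVecLin
  have h3 : LinearMap.ker M.mulVecLin = LinearMap.ker M'.mulVecLin := by
    ext v
    simpa using h v
  rw [h3] at h1
  unfold Matrix.rank
  omega

theorem aux_core {n m N L : ℕ} (A : Matrix (Fin n) (Fin n) ℝ) (B : Matrix (Fin n) (Fin m) ℝ)
    (hc : ∀ ξ : Fin n → ℝ, (∀ k < n, ξ ᵥ* (A ^ k * B) = 0) → ξ = 0)
    (x : ℕ → Fin n → ℝ) (u : ℕ → Fin m → ℝ)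
    (hrec : ∀ t < N, x (t + 1) = A *ᵥ x t + B *ᵥ u t)
    (hPE : ∀ w : ℕ → Fin m → ℝ,
      (∀ j, j + (L + n) ≤ N → ∑ i ∈ Finset.range (L + n), w i ⬝ᵥ u (j + i) = 0) →
      ∀ i < L + n, w i = 0)
    (ξ : Fin n → ℝ) (η : ℕ → Fin m → ℝ)
    (h : ∀ j, j + L ≤ N → ξ ⬝ᵥ x j + ∑ i ∈ Finset.range L, η i ⬝ᵥ u (j + i) = 0) :
    ξ = 0 ∧ ∀ i < L, η i = 0 := by
  obtain ⟨σ, hσ⟩ : ∃ σ : ℕ → Fin m → ℝ, σ = fun e =>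
    if e < n then ξ ᵥ* (A ^ (n - 1 - e) * B) else if e < L + n then η (e - n) else 0 := ⟨_, rfl⟩
  have hσ0 : ∀ e, L + n ≤ e → σ e = 0 := by
    intro e he
    rw [hσ]
    simp only
    rw [if_neg (by omega), if_neg (by omega)]
  have hσ1 : ∀ e < n, σ e = ξ ᵥ* (A ^ (n - 1 - e) * B) := by
    intro e he
    rw [hσ]
    simp only
    rw [if_pos he]
  have hσ2 : ∀ i < L, σ (i + n) = η i := by
    intro i hi
    rw [hσ]
    simp only
    rw [if_neg (by omega), if_pos (by omega)]
    simp
  have hF : ∀ k ≤ n, ∀ j, j + (L + k) ≤ N →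
      (ξ ᵥ* A ^ k) ⬝ᵥ x j + ∑ i ∈ Finset.range (L + k), σ (i + n - k) ⬝ᵥ u (j + i) = 0 := by
    intro k
    induction k with
    | zero =>
      intro _ j hj
      rw [← h j (by omega)]
      simp only [pow_zero, Matrix.vecMul_one, add_zero]
      congr 1
      apply Finset.sum_congr rfl
      intro i hi
      rw [Nat.sub_zero, hσ2 i (Finset.mem_range.mp hi)]
    | succ k ih =>
      intro hk j hj
      rw [← ih (by omega) (j + 1) (by omega), ← add_assoc L k 1, Finset.sum_range_succ',
        hrec j (by omega), hσ1 _ (by omega)]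
      have e1 : n - 1 - (0 + n - (k + 1)) = k := by omega
      rw [e1, dotProduct_add, Matrix.dotProduct_mulVec, Matrix.dotProduct_mulVec,
        Matrix.vecMul_vecMul, Matrix.vecMul_vecMul, ← pow_succ]
      have e2 : ∀ i ∈ Finset.range (L + k), σ (i + 1 + n - (k + 1)) ⬝ᵥ u (j + (i + 1))
          = σ (i + n - k) ⬝ᵥ u (j + 1 + i) := by
        intro i _
        congr 2 <;> omega
      rw [Finset.sum_congr rfl e2]
      simp only [add_zero]
      ring
  have hF' : ∀ k ≤ n, ∀ j, j + (L + n) ≤ N →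
      (ξ ᵥ* A ^ k) ⬝ᵥ x j + ∑ i ∈ Finset.range (L + n), σ (i + n - k) ⬝ᵥ u (j + i) = 0 := by
    intro k hk j hj
    rw [← hF k hk j (by omega)]
    congr 1
    symm
    apply Finset.sum_subset
    · intro i hi
      simp only [Finset.mem_range] at *
      omega
    · intro i _ hi
      rw [Finset.mem_range] at hi
      rw [hσ0 _ (by omega), zero_dotProduct]
  have hdeg : A.charpoly.natDegree = n := by simp [Matrix.charpoly_natDegree_eq_dim]
  have hCH : ∑ k ∈ Finset.range (n + 1), A.charpoly.coeff k • A ^ k = 0 := by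
    have := Matrix.aeval_self_charpoly A
    rw [Polynomial.aeval_eq_sum_range, hdeg] at this
    exact this
  have hlead : A.charpoly.coeff n = 1 := by
    have := Matrix.charpoly_monic A
    rw [Polynomial.Monic, Polynomial.leadingCoeff, hdeg] at this
    exact this
  have hw := hPE (fun i => ∑ k ∈ Finset.range (n + 1), A.charpoly.coeff k • σ (i + n - k)) (by
    intro j hj
    have e0 : ∑ k ∈ Finset.range (n + 1), A.charpoly.coeff k * ((ξ ᵥ* A ^ k) ⬝ᵥ x j +
        ∑ i ∈ Finset.range (L + n), σ (i + n - k) ⬝ᵥ u (j + i)) = 0 := by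
      apply Finset.sum_eq_zero
      intro k hk
      rw [Finset.mem_range] at hk
      rw [hF' k (by omega) j hj, mul_zero]
    have e1 : ∑ k ∈ Finset.range (n + 1), A.charpoly.coeff k * ((ξ ᵥ* A ^ k) ⬝ᵥ x j) = 0 := by
      have : ξ ⬝ᵥ ((∑ k ∈ Finset.range (n + 1), A.charpoly.coeff k • A ^ k) *ᵥ x j) = 0 := by
        rw [hCH]; simp
      rw [← this, Matrix.sum_mulVec, dotProduct_sum]
      apply Finset.sum_congr rfl
      intro k _
      rw [Matrix.smul_mulVec, dotProduct_smul, Matrix.dotProduct_mulVec, smul_eq_mul]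
    simp only [mul_add, Finset.sum_add_distrib] at e0
    rw [e1, zero_add] at e0
    rw [← e0]
    simp only [sum_dotProduct, Finset.mul_sum, smul_dotProduct, smul_eq_mul]
    rw [Finset.sum_comm])
  have hz : ∀ d e, L + n ≤ e + d → σ e = 0 := by
    intro d
    induction d using Nat.strong_induction_on with
    | _ d ih =>
      intro e he
      by_cases hle : L + n ≤ e
      · exact hσ0 e hle
      have := hw e (by omega)
      simp only [Finset.sum_range_succ] at this
      rw [Finset.sum_eq_zero, hlead, zero_add, one_smul] at this
      · simpa using this
      · intro k hk
        rw [Finset.mem_range] at hk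
        rw [ih (d - 1) (by omega) _ (by omega), smul_zero]
  have hz' : ∀ e, σ e = 0 := fun e => hz (L + n) e (by omega)
  constructor
  · apply hc
    intro k hk
    have := hσ1 (n - 1 - k) (by omega)
    rw [hz', show n - 1 - (n - 1 - k) = k by omega] at this
    exact this.symm
  · intro i hi
    rw [← hσ2 i hi, hz']

/-- The noise-free signal matrix `col(H_L(u^d), H_L(y^d))` of a minimal system, with `L ≥ n_x`
and input persistently exciting of order `L + n_x`, has rank exactly `n_x + n_u·L`. -/
theorem signal_matrix_rank {n_x n_u n_y N L : ℕ}
    (A : Matrix (Fin n_x) (Fin n_x) ℝ) (B : Matrix (Fin n_x) (Fin n_u) ℝ)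
    (C : Matrix (Fin n_y) (Fin n_x) ℝ) (D : Matrix (Fin n_y) (Fin n_u) ℝ)
    (hctrb : (ctrbMat A B).rank = n_x) (hobsv : (obsvMat A C).rank = n_x)
    (ud : Fin N → Fin n_u → ℝ) (yd : Fin N → Fin n_y → ℝ)
    (hdata : IsTraj A B C D N ud yd)
    (hLx : n_x ≤ L) (hPEN : L + n_x ≤ N)
    (hPE : (hankel (L + n_x) hPEN ud).rank = (L + n_x) * n_u) :
    (Matrix.fromRows (hankel L (by omega) ud) (hankel L (by omega) yd)).rank
      = n_x + n_u * L := by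
  classical
  obtain ⟨x, hx⟩ := hdata
  obtain ⟨X, hX⟩ : ∃ X : ℕ → Fin n_x → ℝ, X = fun t => if h : t < N + 1 then x ⟨t, h⟩ else 0 :=
    ⟨_, rfl⟩
  obtain ⟨U, hU⟩ : ∃ U : ℕ → Fin n_u → ℝ, U = fun t => if h : t < N then ud ⟨t, h⟩ else 0 :=
    ⟨_, rfl⟩
  obtain ⟨Y, hY⟩ : ∃ Y : ℕ → Fin n_y → ℝ, Y = fun t => if h : t < N then yd ⟨t, h⟩ else 0 :=
    ⟨_, rfl⟩
  have hUd : ∀ t (h : t < N), ud ⟨t, h⟩ = U t := by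
    intro t h; rw [hU]; simp [h]
  have hYd : ∀ t (h : t < N), yd ⟨t, h⟩ = Y t := by
    intro t h; rw [hY]; simp [h]
  have hXd : ∀ t (h : t < N + 1), x ⟨t, h⟩ = X t := by
    intro t h; rw [hX]; simp [h]
  have hrec : ∀ t < N, X (t + 1) = A *ᵥ X t + B *ᵥ U t := by
    intro t ht
    have := (hx ⟨t, ht⟩).1
    rw [hUd] at this
    simp only [Fin.succ_mk, Fin.castSucc_mk, hXd] at this
    exact this
  have hout : ∀ t < N, Y t = C *ᵥ X t + D *ᵥ U t := by
    intro t ht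
    have := (hx ⟨t, ht⟩).2
    rw [hUd, hYd] at this
    simp only [Fin.castSucc_mk, hXd] at this
    exact this
  have hc : ∀ ξ : Fin n_x → ℝ, (∀ k < n_x, ξ ᵥ* (A ^ k * B) = 0) → ξ = 0 := by
    intro ξ h
    apply aux_left (ctrbMat A B) (by simpa using hctrb)
    funext p
    exact congrFun (h p.1.1 p.1.2) p.2
  have ho : ∀ v : Fin n_x → ℝ, (∀ k < n_x, (C * A ^ k) *ᵥ v = 0) → v = 0 := by
    intro v h
    apply aux_ker (obsvMat A C) (by simpa using hobsv)
    funext p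
    exact congrFun (h p.1.1 p.1.2) p.2
  have hP : ∀ w : ℕ → Fin n_u → ℝ,
      (∀ j, j + (L + n_x) ≤ N → ∑ i ∈ Finset.range (L + n_x), w i ⬝ᵥ U (j + i) = 0) →
      ∀ i < L + n_x, w i = 0 := by
    intro w h i hi
    have := aux_left (hankel (L + n_x) hPEN ud) (by simpa using hPE) (fun p => w p.1.1 p.2) (by
      funext j
      have hj := h j.1 (by have := j.2; omega)
      rw [Finset.sum_range] at hj
      simp only [Matrix.vecMul, dotProduct, Fintype.sum_prod_type, hankel, hUd] at hj ⊢
      simp only [add_comm j.1] at hj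
      exact hj)
    funext c
    exact congrFun this (⟨i, hi⟩, c)
  have hLN : L ≤ N := by omega
  obtain ⟨XM, hXM⟩ : ∃ XM : Matrix (Fin n_x) (Fin (N - L + 1)) ℝ, ∀ a j, XM a j = X j.1 a :=
    ⟨fun a j => X j.1 a, fun _ _ => rfl⟩
  obtain ⟨M, hMdef⟩ : ∃ M : Matrix ((Fin L × Fin n_u) ⊕ Fin n_x) (Fin (N - L + 1)) ℝ,
    M = Matrix.fromRows (hankel L hLN ud) XM := ⟨_, rfl⟩
  have hM : M.rank = n_x + n_u * L := by
    rw [aux_rank_left M]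
    · simp; ring
    · intro v hv
      obtain ⟨h1, h2⟩ := aux_core A B hc X U hrec hP (fun a => v (Sum.inr a))
        (fun i c => if h : i < L then v (Sum.inl (⟨i, h⟩, c)) else 0) (by
          intro j hj
          have := congrFun hv ⟨j, by omega⟩
          rw [Finset.sum_range]
          rw [hMdef] at this
          simp only [Matrix.vecMul, dotProduct, Fintype.sum_sum_type, Fintype.sum_prod_type,
            Matrix.fromRows_apply_inl, Matrix.fromRows_apply_inr, hankel, hUd, hXM] at this
          simp only [dotProduct, Fin.is_lt, dif_pos, Fin.eta, add_comm j]
          rw [add_comm]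
          exact this)
      funext s
      rcases s with ⟨i, c⟩ | a
      · have := congrFun (h2 i.1 i.2) c
        simpa using this
      · exact congrFun h1 a
  rw [← hM]
  apply aux_rank_eq
  intro v
  let XV : ℕ → Fin n_x → ℝ := fun i => ∑ j : Fin (N - L + 1), v j • X (i + j.1)
  let UV : ℕ → Fin n_u → ℝ := fun i => ∑ j : Fin (N - L + 1), v j • U (i + j.1)
  let YV : ℕ → Fin n_y → ℝ := fun i => ∑ j : Fin (N - L + 1), v j • Y (i + j.1)
  have hXV : ∀ i < L, XV (i + 1) = A *ᵥ XV i + B *ᵥ UV i := by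
    intro i hi
    simp only [XV, UV, Matrix.mulVec_sum, ← Finset.sum_add_distrib, Matrix.mulVec_smul, ← smul_add]
    apply Finset.sum_congr rfl
    intro j _
    have := j.2
    rw [← hrec _ (by omega), add_right_comm]
  have hYV : ∀ i < L, YV i = C *ᵥ XV i + D *ᵥ UV i := by
    intro i hi
    simp only [XV, UV, YV, Matrix.mulVec_sum, ← Finset.sum_add_distrib, Matrix.mulVec_smul,
      ← smul_add]
    apply Finset.sum_congr rfl
    intro j _
    have := j.2
    rw [← hout _ (by omega)]
  have kU : hankel L hLN ud *ᵥ v = 0 ↔ ∀ i < L, UV i = 0 := by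
    have e : ∀ p : Fin L × Fin n_u, (hankel L hLN ud *ᵥ v) p = UV p.1.1 p.2 := by
      intro p
      simp [Matrix.mulVec, dotProduct, hankel, hUd, UV, Finset.sum_apply, mul_comm]
    constructor
    · intro h i hi
      funext c
      rw [← e (⟨i, hi⟩, c), h]; rfl
    · intro h
      funext p
      rw [e, h _ p.1.2]; rfl
  have kY : hankel L hLN yd *ᵥ v = 0 ↔ ∀ i < L, YV i = 0 := by
    have e : ∀ p : Fin L × Fin n_y, (hankel L hLN yd *ᵥ v) p = YV p.1.1 p.2 := by
      intro p
      simp [Matrix.mulVec, dotProduct, hankel, hYd, YV, Finset.sum_apply, mul_comm]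
    constructor
    · intro h i hi
      funext c
      rw [← e (⟨i, hi⟩, c), h]; rfl
    · intro h
      funext p
      rw [e, h _ p.1.2]; rfl
  have kX : XM *ᵥ v = XV 0 := by
    funext a
    simp [Matrix.mulVec, dotProduct, XV, hXM, Finset.sum_apply, mul_comm]
  have hsplit : ∀ {α β : Type} [Fintype α] [Fintype β] (P : Matrix α (Fin (N - L + 1)) ℝ)
      (Q : Matrix β (Fin (N - L + 1)) ℝ),
      Matrix.fromRows P Q *ᵥ v = 0 ↔ P *ᵥ v = 0 ∧ Q *ᵥ v = 0 := by
    intro α β _ _ P Q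
    rw [Matrix.fromRows_mulVec]
    constructor
    · intro h
      exact ⟨funext fun a => congrFun h (Sum.inl a), funext fun a => congrFun h (Sum.inr a)⟩
    · rintro ⟨h1, h2⟩
      rw [h1, h2]
      funext s
      rcases s with a | a <;> rfl
  rw [hMdef, hsplit, hsplit, kU, kY, kX]
  apply and_congr_right
  intro hu
  have hpow : ∀ i ≤ L, XV i = A ^ i *ᵥ XV 0 := by
    intro i
    induction i with
    | zero => intro _; simp
    | succ i ih =>
      intro hi
      rw [hXV i (by omega), hu i (by omega), ih (by omega), Matrix.mulVec_zero, add_zero,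
        Matrix.mulVec_mulVec, pow_succ']
  have hy : ∀ i < L, YV i = (C * A ^ i) *ᵥ XV 0 := by
    intro i hi
    rw [hYV i hi, hu i hi, hpow i hi.le, Matrix.mulVec_zero, add_zero, Matrix.mulVec_mulVec]
  constructor
  · intro h
    apply ho
    intro k hk
    rw [← hy k (by omega), h k (by omega)]
  · intro h i hi
    rw [hy i hi, h, Matrix.mulVec_zero]
end

section
/- Let U ∈ ℝ^{r×M₁}, Y_p ∈ ℝ^{q×M₁}, Y_f ∈ ℝ^{s×M₁} and Ũ ∈ ℝ^{r×M₂}, Ỹ_p ∈ ℝ^{q×M₂}, Ỹ_f ∈ ℝ^{s×M₂}, and suppose the stacked matrices S = col(U, Y_p, Y_f) and S̃ = col(Ũ, Ỹ_p, Ỹ_f) satisfy S·Sᵀ = S̃·S̃ᵀ. Let λ > 0, y ∈ ℝ^q, and let b ∈ ℝ^r lie in the column space of U. Then b also lies in the column space of Ũ, and the unique minimizers g* of λ‖g‖₂² + ‖Y_p g − y‖₂² over {g ∈ ℝ^{M₁} : U g = b} and g̃* of λ‖g̃‖₂² + ‖Ỹ_p g̃ − y‖₂² over {g̃ ∈ ℝ^{M₂}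 : Ũ g̃ = b} satisfy Y_f·g* = Ỹ_f·g̃* and ‖g*‖₂ = ‖g̃*‖₂. (Hence the SMM predictive control iteration, whose predictor and regularization weight depend on the signal matrix only through Y_f g* and ‖g*‖₂, gives identical results for any two signal matrices with equal Gram matrices.) -/
open Matrix

/-- The equality-constrained ridge cost `J(g) = λ‖g‖₂² + ‖Y_p g − y‖₂²`. -/
def ridgeCost {q M : ℕ} (lam : ℝ) (Yp : Matrix (Fin q) (Fin M) ℝ) (y : Fin q → ℝ)
    (g : Fin M → ℝ) : ℝ :=
  lam * ∑ i, g i ^ 2 + ∑ i, (Yp.mulVec g i - y i) ^ 2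


lemma exists_gram_solve {n : Type*} [Fintype n] {M : ℕ} (S : Matrix n (Fin M) ℝ)
    (g : Fin M → ℝ) : ∃ c, (S * Sᵀ).mulVec c = S.mulVec g := by
  have hle : LinearMap.range (S * Sᵀ).mulVecLin ≤ LinearMap.range S.mulVecLin := by
    rintro _ ⟨c, rfl⟩
    exact ⟨Sᵀ.mulVec c, Matrix.mulVec_mulVec c S Sᵀ⟩
  have hr : (S * Sᵀ).rank = S.rank := Matrix.rank_self_mul_transpose S
  have heq := Submodule.eq_of_le_of_finrank_eq hle hr
  have hm : S.mulVec g ∈ LinearMap.range S.mulVecLin := ⟨g, rfl⟩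
  rw [← heq] at hm
  obtain ⟨c, hc⟩ := hm
  exact ⟨c, hc⟩

lemma sum_sq_eq_dot {M : ℕ} (g : Fin M → ℝ) : ∑ i, g i ^ 2 = g ⬝ᵥ g := by
  simp [dotProduct, pow_two]

lemma dot_transpose {n : Type*} [Fintype n] {M : ℕ} (S : Matrix n (Fin M) ℝ)
    (c : n → ℝ) (w : Fin M → ℝ) : Sᵀ.mulVec c ⬝ᵥ w = c ⬝ᵥ S.mulVec w := by
  rw [Matrix.mulVec_transpose, Matrix.dotProduct_mulVec]

lemma gram_transfer {n : Type*} [Fintype n] {M₁ M₂ : ℕ} (S : Matrix n (Fin M₁) ℝ)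
    (T : Matrix n (Fin M₂) ℝ) (h : S * Sᵀ = T * Tᵀ) (g : Fin M₁ → ℝ) :
    ∃ k, T.mulVec k = S.mulVec g ∧ ∑ i, k i ^ 2 ≤ ∑ i, g i ^ 2 := by
  obtain ⟨c, hc⟩ := exists_gram_solve S g
  refine ⟨Tᵀ.mulVec c, ?_, ?_⟩
  · rw [Matrix.mulVec_mulVec, ← h, hc]
  · rw [sum_sq_eq_dot, sum_sq_eq_dot, dot_transpose, Matrix.mulVec_mulVec, ← h, hc,
      ← dot_transpose]
    have h1 : Sᵀ.mulVec c ⬝ᵥ Sᵀ.mulVec c = Sᵀ.mulVec c ⬝ᵥ g := by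
      rw [dot_transpose, dot_transpose, Matrix.mulVec_mulVec, hc]
    have h2 : 0 ≤ (g - Sᵀ.mulVec c) ⬝ᵥ (g - Sᵀ.mulVec c) := by
      rw [← sum_sq_eq_dot]; positivity
    rw [sub_dotProduct, dotProduct_sub, dotProduct_sub, dotProduct_comm g (Sᵀ.mulVec c)] at h2
    linarith

lemma stack_eq {r q s M₁ M₂ : ℕ}
    {U : Matrix (Fin r) (Fin M₁) ℝ} {Yp : Matrix (Fin q) (Fin M₁) ℝ}
    {Yf : Matrix (Fin s) (Fin M₁) ℝ}
    {Ut : Matrix (Fin r) (Fin M₂) ℝ} {Ypt : Matrix (Fin q) (Fin M₂) ℝ}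
    {Yft : Matrix (Fin s) (Fin M₂) ℝ} {g : Fin M₁ → ℝ} {k : Fin M₂ → ℝ}
    (h : (Matrix.fromRows (Matrix.fromRows Ut Ypt) Yft).mulVec k =
      (Matrix.fromRows (Matrix.fromRows U Yp) Yf).mulVec g) :
    Ut.mulVec k = U.mulVec g ∧ Ypt.mulVec k = Yp.mulVec g ∧ Yft.mulVec k = Yf.mulVec g := by
  refine ⟨?_, ?_, ?_⟩ <;> funext i
  · exact congrFun h (Sum.inl (Sum.inl i))
  · exact congrFun h (Sum.inl (Sum.inr i))
  · exact congrFun h (Sum.inr i)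

lemma ridge_unique {r q M : ℕ} (lam : ℝ) (hlam : 0 < lam)
    (U : Matrix (Fin r) (Fin M) ℝ) (Yp : Matrix (Fin q) (Fin M) ℝ)
    (y : Fin q → ℝ) (b : Fin r → ℝ) (g k : Fin M → ℝ) (hg : U.mulVec g = b)
    (hk : U.mulVec k = b)
    (hmin : ∀ x, U.mulVec x = b → ridgeCost lam Yp y g ≤ ridgeCost lam Yp y x)
    (hle : ridgeCost lam Yp y k ≤ ridgeCost lam Yp y g) : k = g := by
  have hm := hmin ((1/2 : ℝ) • (g + k)) (by
    rw [Matrix.mulVec_smul, Matrix.mulVec_add, hg, hk]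
    funext i
    simp only [Pi.smul_apply, Pi.add_apply, smul_eq_mul]
    ring)
  have e1 : ∑ i, ((1/2 : ℝ) • (g + k)) i ^ 2 =
      (1/2) * ∑ i, g i ^ 2 + (1/2) * ∑ i, k i ^ 2 - (1/4) * ∑ i, (k i - g i) ^ 2 := by
    rw [Finset.mul_sum, Finset.mul_sum, Finset.mul_sum, ← Finset.sum_add_distrib,
      ← Finset.sum_sub_distrib]
    refine Finset.sum_congr rfl fun i _ => ?_
    simp only [Pi.smul_apply, Pi.add_apply, smul_eq_mul]
    ring
  have e2 : ∑ i, (Yp.mulVec ((1/2 : ℝ) • (g + k)) i - y i) ^ 2 ≤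
      (1/2) * ∑ i, (Yp.mulVec g i - y i) ^ 2 + (1/2) * ∑ i, (Yp.mulVec k i - y i) ^ 2 := by
    rw [Finset.mul_sum, Finset.mul_sum, ← Finset.sum_add_distrib]
    refine Finset.sum_le_sum fun i _ => ?_
    rw [Matrix.mulVec_smul, Matrix.mulVec_add]
    simp only [Pi.smul_apply, Pi.add_apply, smul_eq_mul]
    nlinarith [sq_nonneg (Yp.mulVec g i - Yp.mulVec k i)]
  unfold ridgeCost at hm hle
  rw [e1] at hm
  have h0 : lam * ∑ i, (k i - g i) ^ 2 ≤ 0 := by linarith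
  have hn : 0 ≤ ∑ i, (k i - g i) ^ 2 := by positivity
  have hz : ∑ i, (k i - g i) ^ 2 = 0 := by nlinarith
  rw [Finset.sum_eq_zero_iff_of_nonneg (fun i _ => sq_nonneg _)] at hz
  funext i
  exact sub_eq_zero.mp (pow_eq_zero_iff (two_ne_zero) |>.mp (hz i (Finset.mem_univ i)))

/-- If two signal matrices `S = col(U, Y_p, Y_f)` and `S̃ = col(Ũ, Ỹ_p, Ỹ_f)` have equal Gram
matrices `S Sᵀ = S̃ S̃ᵀ`, then `b ∈ range(U)` implies `b ∈ range(Ũ)`, and the unique minimizers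
of the two constrained ridge problems give the same prediction `Y_f g* = Ỹ_f g̃*` and have
equal Euclidean norms. -/
theorem ridge_minimizer_gram_invariance {r q s M₁ M₂ : ℕ} (lam : ℝ) (hlam : 0 < lam)
    (U : Matrix (Fin r) (Fin M₁) ℝ) (Yp : Matrix (Fin q) (Fin M₁) ℝ)
    (Yf : Matrix (Fin s) (Fin M₁) ℝ)
    (Ut : Matrix (Fin r) (Fin M₂) ℝ) (Ypt : Matrix (Fin q) (Fin M₂) ℝ)
    (Yft : Matrix (Fin s) (Fin M₂) ℝ)
    (hGram : Matrix.fromRows (Matrix.fromRows U Yp) Yf *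
        (Matrix.fromRows (Matrix.fromRows U Yp) Yf)ᵀ =
      Matrix.fromRows (Matrix.fromRows Ut Ypt) Yft *
        (Matrix.fromRows (Matrix.fromRows Ut Ypt) Yft)ᵀ)
    (y : Fin q → ℝ) (b : Fin r → ℝ) (hb : ∃ g, U.mulVec g = b) :
    (∃ gt, Ut.mulVec gt = b) ∧
    ∀ (gstar : Fin M₁ → ℝ) (gtstar : Fin M₂ → ℝ),
      (U.mulVec gstar = b ∧
        ∀ g, U.mulVec g = b → ridgeCost lam Yp y gstar ≤ ridgeCost lam Yp y g) →
      (Ut.mulVec gtstar = b ∧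
        ∀ g, Ut.mulVec g = b → ridgeCost lam Ypt y gtstar ≤ ridgeCost lam Ypt y g) →
      Yf.mulVec gstar = Yft.mulVec gtstar ∧
        Real.sqrt (∑ i, gstar i ^ 2) = Real.sqrt (∑ i, gtstar i ^ 2) := by
  constructor
  · obtain ⟨g, rfl⟩ := hb
    obtain ⟨k, hk, -⟩ := gram_transfer _ _ hGram g
    exact ⟨k, (stack_eq hk).1⟩
  · rintro g gt ⟨hg, hgm⟩ ⟨hgt, hgtm⟩
    obtain ⟨h, hh, hhn⟩ := gram_transfer _ _ hGram g
    obtain ⟨k, hk, hkn⟩ := gram_transfer _ _ hGram.symm gt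
    obtain ⟨h1, h2, h3⟩ := stack_eq hh
    obtain ⟨k1, k2, k3⟩ := stack_eq hk
    have a1 := hgtm h (h1.trans hg)
    have a2 := hgm k (k1.trans hgt)
    have b1 : ridgeCost lam Ypt y h ≤ ridgeCost lam Yp y g := by
      unfold ridgeCost
      rw [h2]
      gcongr
    have b2 : ridgeCost lam Yp y k ≤ ridgeCost lam Ypt y gt := by
      unfold ridgeCost
      rw [k2]
      gcongr
    have hu : h = gt := ridge_unique lam hlam Ut Ypt y b gt h hgt (h1.trans hg) hgtm
      (b1.trans (a2.trans b2))
    subst hu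
    refine ⟨h3.symm, ?_⟩
    have hc : ridgeCost lam Yp y g ≤ ridgeCost lam Ypt y h := a2.trans b2
    unfold ridgeCost at hc
    rw [h2] at hc
    have hs : ∑ i, g i ^ 2 ≤ ∑ i, h i ^ 2 := le_of_mul_le_mul_left (by linarith) hlam
    rw [le_antisymm hs hhn]
end
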